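/- Let b be a nonextreme function in the unit ball of H^∞ with pair (b,a), let λ ∈ ∂𝔻 with μ_λ absolutely continuous, and set F_λ = a/(1 − λ̄b). Then for every w ∈ 𝔻, (1 − λ̄ b(z)) · T_{F̄_λ}( (1 − λ·conj(b(w))) F_λ k_w )(z) = k_w^b(z), where k_w(z) = (1 − w̄z)^{−1} and k_w^b(z) = (1 − conj(b(w)) b(z))/(1 − w̄z); equivalently, V_{λ̄b}( (1 − λ·conj(b(w))) k_w ) = k_w^b, where V_{λ̄b} is the canonical isometry of H²(μ_λ) onto H(λ̄b). -/

import Mathlib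

open Complex MeasureTheory Filter Set

noncomputable section

/-! ### Basic framework: Hardy spaces on the unit disk via boundary values -/

/-- The open unit disk in the complex plane. -/
def unitDisk : Set ℂ := Metric.ball 0 1

/-- The point `e^{iθ}` of the unit circle. -/
def uc (θ : ℝ) : ℂ := Complex.exp ((θ : ℂ) * Complex.I)

/-- Lebesgue measure on the parameter interval `(0, 2π]` of the unit circle. -/
def bMeasure : Measure ℝ := volume.restrict (Set.Ioc 0 (2 * Real.pi))

/-- Radial limit of `f` at the boundary point `w` (`|w| = 1`). -/
def radLim (f : ℂ → ℂ) (w : ℂ) : ℂ :=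
  limUnder (nhdsWithin (1 : ℝ) (Set.Iio 1)) fun r : ℝ => f ((r : ℂ) * w)

/-- The boundary value function of `f` on the unit circle. -/
def bdry (f : ℂ → ℂ) (θ : ℝ) : ℂ := radLim f (uc θ)

/-- Membership in the Hardy space `H²` of the unit disk. -/
def MemH2 (f : ℂ → ℂ) : Prop :=
  DifferentiableOn ℂ f unitDisk ∧
    ∃ C : ℝ, ∀ r ∈ Set.Ico (0 : ℝ) 1,
      (∫ θ in (0:ℝ)..(2 * Real.pi), ‖f ((r : ℂ) * uc θ)‖ ^ 2) ≤ C

/-- Membership in the Hardy space `H¹` of the unit disk. -/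
def MemH1 (f : ℂ → ℂ) : Prop :=
  DifferentiableOn ℂ f unitDisk ∧
    ∃ C : ℝ, ∀ r ∈ Set.Ico (0 : ℝ) 1,
      (∫ θ in (0:ℝ)..(2 * Real.pi), ‖f ((r : ℂ) * uc θ)‖) ≤ C

/-- Membership in `H^∞` (bounded holomorphic functions on the disk). -/
def MemHinf (f : ℂ → ℂ) : Prop :=
  DifferentiableOn ℂ f unitDisk ∧ ∃ C : ℝ, ∀ z ∈ unitDisk, ‖f z‖ ≤ C

/-- The `H²` (normalized boundary `L²`) inner product `⟨f, g⟩`. -/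
def bInner (f g : ℂ → ℂ) : ℂ :=
  (1 / (2 * (Real.pi : ℂ))) *
    ∫ θ in (0:ℝ)..(2 * Real.pi), bdry f θ * (starRingEnd ℂ) (bdry g θ)

/-- The squared `H²` norm, computed on the boundary. -/
def bNormSq (f : ℂ → ℂ) : ℝ :=
  (1 / (2 * Real.pi)) * ∫ θ in (0:ℝ)..(2 * Real.pi), ‖bdry f θ‖ ^ 2

/-- `f` is an inner function. -/
def IsInner (f : ℂ → ℂ) : Prop :=
  DifferentiableOn ℂ f unitDisk ∧ (∀ z ∈ unitDisk, ‖f z‖ ≤ 1) ∧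
    ∀ᵐ θ ∂bMeasure, ‖bdry f θ‖ = 1

/-- `f` is an outer function: it is, up to a unimodular constant, the Herglotz
exponential of the Poisson integral of `log |f*|`. -/
def IsOuter (f : ℂ → ℂ) : Prop :=
  DifferentiableOn ℂ f unitDisk ∧ ∃ c : ℂ, ‖c‖ = 1 ∧ ∀ z ∈ unitDisk,
    f z = c * Complex.exp ((1 / (2 * (Real.pi : ℂ))) *
      ∫ θ in (0:ℝ)..(2 * Real.pi),
        ((uc θ + z) / (uc θ - z)) * ((Real.log ‖bdry f θ‖ : ℝ) : ℂ))

/-- `b` is a nonextreme point of the closed unit ball of `H^∞`: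
`log (1 - |b|)` is integrable on the circle. -/
def Nonextreme (b : ℂ → ℂ) : Prop :=
  DifferentiableOn ℂ b unitDisk ∧ (∀ z ∈ unitDisk, ‖b z‖ ≤ 1) ∧
    Integrable (fun θ => Real.log (1 - ‖bdry b θ‖)) bMeasure

/-- `(b, a)` is a pair: `b` nonextreme, `a` outer, `|a|² + |b|² = 1` a.e. on the circle. -/
def IsPair (b a : ℂ → ℂ) : Prop :=
  Nonextreme b ∧ IsOuter a ∧
    ∀ᵐ θ ∂bMeasure, ‖bdry a θ‖ ^ 2 + ‖bdry b θ‖ ^ 2 = 1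

/-- `(b, a)` is the pair associated with the outer function `f` of unit `H²` norm:
`f = a / (1 - b)`. -/
def PairAssoc (f b a : ℂ → ℂ) : Prop :=
  IsOuter f ∧ MemH2 f ∧ bNormSq f = 1 ∧ IsPair b a ∧
    ∀ z ∈ unitDisk, f z = a z / (1 - b z)

/-- The Herglotz measure `μ_λ` of `(1 + λ̄b)/(1 − λ̄b)` is absolutely continuous:
the Herglotz representation holds with density `|a/(1 − λ̄b)|²` and no singular part. -/
def HerglotzAC (b a : ℂ → ℂ) (lam : ℂ) : Prop :=
  ∀ z ∈ unitDisk,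
    (1 + (starRingEnd ℂ) lam * b z) / (1 - (starRingEnd ℂ) lam * b z) =
      (1 / (2 * (Real.pi : ℂ))) *
        (∫ θ in (0:ℝ)..(2 * Real.pi),
          ((1 + (uc θ)⁻¹ * z) / (1 - (uc θ)⁻¹ * z)) *
            ((‖bdry (fun w => a w / (1 - (starRingEnd ℂ) lam * b w)) θ‖ ^ 2 : ℝ) : ℂ)) +
      Complex.I *
        ((((1 + (starRingEnd ℂ) lam * b 0) / (1 - (starRingEnd ℂ) lam * b 0)).im : ℝ) : ℂ)

/-- The pair `(b, a)` is special: the Herglotz measure of `(1+b)/(1−b)` is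
absolutely continuous. -/
def SpecialPair (b a : ℂ → ℂ) : Prop := IsPair b a ∧ HerglotzAC b a 1

/-- `F ∈ H¹` is rigid: the only functions of `H¹` with the same argument a.e. on the
circle are the positive scalar multiples of `F`. -/
def Rigid (F : ℂ → ℂ) : Prop :=
  MemH1 F ∧ ∀ G : ℂ → ℂ, MemH1 G →
    (∀ᵐ θ ∂bMeasure, ∃ t : ℝ, 0 < t ∧ bdry G θ = (t : ℂ) * bdry F θ) →
    ∃ c : ℝ, 0 < c ∧ ∀ z ∈ unitDisk, G z = (c : ℂ) * F z

/-- The Riesz (analytic) projection `P₊` of a boundary function, realized through the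
Szegő integral: `(P₊u)(z) = (1/2π) ∫ u(θ) (1 − z e^{-iθ})⁻¹ dθ`. -/
def szProj (u : ℝ → ℂ) : ℂ → ℂ := fun z =>
  (1 / (2 * (Real.pi : ℂ))) *
    ∫ θ in (0:ℝ)..(2 * Real.pi), u θ * (1 - z * (uc θ)⁻¹)⁻¹

/-- The Toeplitz operator with boundary symbol `φ`: `T_φ h = P₊(φ · h*)`. -/
def toeplitz (φ : ℝ → ℂ) (h : ℂ → ℂ) : ℂ → ℂ := szProj fun θ => φ θ * bdry h θ

/-- The kernel of the Toeplitz operator `T_φ`, as a subset of `H²`. -/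
def toeplitzKer (φ : ℝ → ℂ) : Set (ℂ → ℂ) :=
  {h | MemH2 h ∧ ∀ z ∈ unitDisk, toeplitz φ h z = 0}

/-- The boundary symbol `ḡ` of a function `g` on the disk. -/
def conjBdry (g : ℂ → ℂ) : ℝ → ℂ := fun θ => (starRingEnd ℂ) (bdry g θ)

/-- The boundary symbol `ḡ/g`. -/
def symbQuot (g : ℂ → ℂ) : ℝ → ℂ := fun θ => (starRingEnd ℂ) (bdry g θ) / bdry g θ

/-- The boundary symbol `Ī f̄ / f`. -/
def symbIf (I f : ℂ → ℂ) : ℝ → ℂ :=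
  fun θ => (starRingEnd ℂ) (bdry I θ) * (starRingEnd ℂ) (bdry f θ) / bdry f θ

/-- The model space `K_I = H² ⊖ I H² = ker T_Ī` of an inner function `I`. -/
def modelSpace (I : ℂ → ℂ) : Set (ℂ → ℂ) := toeplitzKer (conjBdry I)

/-- The set `f·K_I`. -/
def fModel (f I : ℂ → ℂ) : Set (ℂ → ℂ) :=
  {g | ∃ h ∈ modelSpace I, ∀ z ∈ unitDisk, g z = f z * h z}

/-- The orthogonal complement `ker T_{Ī f̄/f} ⊖ f·K_I` of `f·K_I` in the kernel of
`T_{Ī f̄/f}`, with respect to the `H²` inner product. -/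
def kerPerp (I f : ℂ → ℂ) : Set (ℂ → ℂ) :=
  {h | h ∈ toeplitzKer (symbIf I f) ∧ ∀ g ∈ fModel f I, bInner h g = 0}

/-- `M(a) = T_a H² = a·H²` (for `a ∈ H^∞`), the range of `T_a`, as a set. -/
def rangeMa (a : ℂ → ℂ) : Set (ℂ → ℂ) :=
  {g | ∃ h, MemH2 h ∧ ∀ z ∈ unitDisk, g z = a z * h z}

/-- Membership in the de Branges–Rovnyak space `H(b)` for nonextreme `b` with
pair `(b, a)`:  `h ∈ H(b)` iff `h ∈ H²` and `T_b̄ h = T_ā h⁺` for some `h⁺ ∈ H²`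
(Sarason's characterization). -/
def MemHb (b a h : ℂ → ℂ) : Prop :=
  MemH2 h ∧ ∃ h' : ℂ → ℂ, MemH2 h' ∧
    ∀ z ∈ unitDisk, toeplitz (conjBdry b) h z = toeplitz (conjBdry a) h' z

/-- The function `h⁺ ∈ H²` with `T_b̄ h = T_ā h⁺` (unique when it exists, since `a`
is outer). -/
def plusFun (b a h : ℂ → ℂ) : ℂ → ℂ :=
  Classical.epsilon fun h' : ℂ → ℂ => MemH2 h' ∧
    ∀ z ∈ unitDisk, toeplitz (conjBdry b) h z = toeplitz (conjBdry a) h' z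

/-- The inner product of `H(b)`: `⟨h, g⟩_b = ⟨h, g⟩₂ + ⟨h⁺, g⁺⟩₂`. -/
def hbInner (b a h g : ℂ → ℂ) : ℂ :=
  bInner h g + bInner (plusFun b a h) (plusFun b a g)

/-- The squared norm of `H(b)`. -/
def hbNormSq (b a h : ℂ → ℂ) : ℝ := (hbInner b a h h).re

/-- The closure of a set `S` in the norm of `H(b)`. -/
def hbClosure (b a : ℂ → ℂ) (S : Set (ℂ → ℂ)) : Set (ℂ → ℂ) :=
  {h | MemHb b a h ∧ ∀ ε : ℝ, 0 < ε → ∃ g ∈ S,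
    hbNormSq b a (fun z => h z - g z) < ε}

/-- The orthogonal complement of `S` in `H(b)`. -/
def hbPerp (b a : ℂ → ℂ) (S : Set (ℂ → ℂ)) : Set (ℂ → ℂ) :=
  {h | MemHb b a h ∧ ∀ g ∈ S, hbInner b a h g = 0}

/-- A set of functions on the disk is a `k`-dimensional linear subspace. -/
def HasDimOn (S : Set (ℂ → ℂ)) (k : ℕ) : Prop :=
  ∃ g : Fin k → (ℂ → ℂ), (∀ j, g j ∈ S) ∧
    (∀ c : Fin k → ℂ, (∀ z ∈ unitDisk, (∑ j, c j * g j z) = 0) → c = 0) ∧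
    ∀ h ∈ S, ∃ c : Fin k → ℂ, ∀ z ∈ unitDisk, h z = ∑ j, c j * g j z

/-- The Szegő kernel `k_w(z) = (1 - w̄ z)⁻¹` of `H²`. -/
def szKernel (w z : ℂ) : ℂ := (1 - (starRingEnd ℂ) w * z)⁻¹

/-- The reproducing kernel of `H(b)` at an interior point `w ∈ 𝔻`. -/
def hbKernel (b : ℂ → ℂ) (w z : ℂ) : ℂ :=
  (1 - (starRingEnd ℂ) (b w) * b z) / (1 - (starRingEnd ℂ) w * z)

/-- The boundary kernel of `H(b)` at a boundary point `z₀`, defined through the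
nontangential limit `b(z₀) = radLim b z₀`. -/
def hbBoundaryKernel (b : ℂ → ℂ) (z₀ z : ℂ) : ℂ :=
  (1 - (starRingEnd ℂ) (radLim b z₀) * b z) / (1 - (starRingEnd ℂ) z₀ * z)

/-- `u` is a nontangential approach sequence to the boundary point `z₀`. -/
def NTApproach (u : ℕ → ℂ) (z₀ : ℂ) : Prop :=
  (∀ n, u n ∈ unitDisk) ∧ Filter.Tendsto u Filter.atTop (nhds z₀) ∧
    ∃ M : ℝ, ∀ n, ‖u n - z₀‖ ≤ M * (1 - ‖u n‖)

/-- `b` has an angular derivative in the sense of Carathéodory at `z₀ ∈ ∂𝔻`. -/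
def HasADC (b : ℂ → ℂ) (z₀ : ℂ) : Prop :=
  ‖radLim b z₀‖ = 1 ∧ ∃ L : ℂ, ∀ u : ℕ → ℂ, NTApproach u z₀ →
    Filter.Tendsto (fun n => b (u n)) Filter.atTop (nhds (radLim b z₀)) ∧
    Filter.Tendsto (fun n => (b (u n) - radLim b z₀) / (u n - z₀)) Filter.atTop (nhds L)


/-! ### Fatou's theorem for bounded holomorphic functions -/

theorem norm_uc (θ : ℝ) : ‖uc θ‖ = 1 := Complex.norm_exp_ofReal_mul_I θ

theorem uc_ne_zero (θ : ℝ) : uc θ ≠ 0 := Complex.exp_ne_zero _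

theorem uc_inv (θ : ℝ) : (uc θ)⁻¹ = (starRingEnd ℂ) (uc θ) := by
  rw [Complex.inv_def, Complex.normSq_eq_norm_sq, norm_uc]; simp

theorem ofReal_mul_uc_mem {r : ℝ} (h0 : 0 ≤ r) (h1 : r < 1) (θ : ℝ) :
    (r : ℂ) * uc θ ∈ Metric.ball (0 : ℂ) 1 := by
  rw [mem_ball_zero_iff, norm_mul, norm_uc, mul_one, Complex.norm_real, Real.norm_of_nonneg h0]
  exact h1

/-- Cauchy's formula for the derivative of a function continuous up to the boundary. -/
theorem DiffContOnCl.two_pi_I_inv_smul_circleIntegral_sub_sq_inv_smul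
    {c w : ℂ} {R : ℝ} {f : ℂ → ℂ} (hf : DiffContOnCl ℂ f (Metric.ball c R))
    (hw : w ∈ Metric.ball c R) :
    ((2 * Real.pi * I : ℂ)⁻¹ • ∮ z in C(c, R), ((z - w) ^ 2)⁻¹ • f z) = deriv f w := by
  have hR : 0 < R := Metric.pos_of_mem_ball hw
  have hcont : ContinuousOn f (Metric.closedBall c R) := hf.continuousOn_ball
  have hn : Metric.closedBall c R ∈ nhds w :=
    mem_of_superset (Metric.isOpen_ball.mem_nhds hw) Metric.ball_subset_closedBall
  have hd : DifferentiableAt ℂ f w := hf.differentiableAt Metric.isOpen_ball hw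
  have hf' : DiffContOnCl ℂ (dslope f w) (Metric.ball c R) := by
    refine ⟨(Complex.differentiableOn_dslope (Metric.isOpen_ball.mem_nhds hw)).mpr
      hf.differentiableOn, ?_⟩
    rw [closure_ball _ hR.ne']
    exact (continuousOn_dslope hn).mpr ⟨hcont, hd⟩
  have h0 := hf'.two_pi_i_inv_smul_circleIntegral_sub_inv_smul hw
  rw [← dslope_same, ← h0]
  congr 1
  trans ∮ z in C(c, R), ((z - w) ^ 2)⁻¹ • (f z - f w)
  · have h1 : ContinuousOn (fun z : ℂ => ((z - w) ^ 2)⁻¹) (Metric.sphere c R) := by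
      refine ((continuous_id'.sub continuous_const).pow 2).continuousOn.inv₀ fun u hu h => ?_
      exact Metric.sphere_disjoint_ball.ne_of_mem hu hw (sub_eq_zero.mp (sq_eq_zero_iff.mp h))
    have h2 : CircleIntegrable (fun z : ℂ => ((z - w) ^ 2)⁻¹ • f z) c R :=
      ContinuousOn.circleIntegrable hR.le
        (h1.smul (hcont.mono Metric.sphere_subset_closedBall))
    have h3 : CircleIntegrable (fun z : ℂ => ((z - w) ^ 2)⁻¹ • f w) c R :=
      ContinuousOn.circleIntegrable hR.le (h1.smul continuousOn_const)
    have h4 : (∮ z : ℂ in C(c, R), ((z - w) ^ 2)⁻¹) = 0 := by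
      simpa using! circleIntegral.integral_sub_zpow_of_ne (by decide : (-2 : ℤ) ≠ -1) c w R
    simp only [smul_sub, circleIntegral.integral_sub h2 h3, h4, circleIntegral.integral_smul_const,
      zero_smul, sub_zero]
  · refine circleIntegral.integral_congr hR.le fun z hz => ?_
    simp only [dslope_of_ne, Metric.sphere_disjoint_ball.ne_of_mem hz hw, slope, sq,
      mul_inv, Ne, not_false_iff, vsub_eq_sub, smul_eq_mul, mul_assoc]

theorem norm_sub_div_eq {ζ ζ₀ : ℂ} (hζ : ‖ζ‖ = 1) (hζ₀ : ‖ζ₀‖ = 1) {r : ℝ} (hr : 0 < r) :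
    ‖ζ - ζ₀ / r‖ = ‖ζ - r * ζ₀‖ / r := by
  have h1 : ζ - ζ₀ / r = (r * ζ - ζ₀) / r := by
    have : (r : ℂ) ≠ 0 := by exact_mod_cast hr.ne'
    field_simp
  have h2 : ‖r * ζ - ζ₀‖ = ‖ζ - r * ζ₀‖ := by
    rw [← sq_eq_sq₀ (norm_nonneg _) (norm_nonneg _)]
    have a1 : ζ.re ^ 2 + ζ.im ^ 2 = 1 := by
      have := Complex.sq_norm ζ; rw [hζ, Complex.normSq_apply] at this; linarith
    have a2 : ζ₀.re ^ 2 + ζ₀.im ^ 2 = 1 := by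
      have := Complex.sq_norm ζ₀; rw [hζ₀, Complex.normSq_apply] at this; linarith
    rw [Complex.sq_norm, Complex.sq_norm, Complex.normSq_apply, Complex.normSq_apply]
    simp
    linear_combination (r ^ 2 - 1) * a1 + (1 - r ^ 2) * a2
  rw [h1, norm_div, h2, Complex.norm_real, Real.norm_of_nonneg hr.le]

/-- The difference of the kernels `(ζ - z)⁻²` at a point and at its reflection in the circle. -/
theorem norm_sq_inv_sub_sq_inv_le {ζ ζ₀ : ℂ} (hζ : ‖ζ‖ = 1) (hζ₀ : ‖ζ₀‖ = 1) {r : ℝ}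
    (hr : 0 < r) (hr1 : r < 1) :
    ‖((ζ - r * ζ₀) ^ 2)⁻¹ - ((ζ - ζ₀ / r) ^ 2)⁻¹‖ ≤ 4 * (1 - r) / ‖ζ - r * ζ₀‖ ^ 3 := by
  have hn : ‖r * ζ₀‖ = r := by rw [norm_mul, hζ₀, Complex.norm_real, Real.norm_of_nonneg hr.le]; ring
  have hd : 0 < ‖ζ - r * ζ₀‖ := by
    have := norm_sub_norm_le ζ (r * ζ₀)
    rw [hζ, hn] at this; linarith
  have hd' := norm_sub_div_eq hζ hζ₀ hr
  set u := ζ - r * ζ₀ with hu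
  set v := ζ - ζ₀ / r with hv
  set d := ‖u‖ with hdd
  have hu0 : u ≠ 0 := norm_pos_iff.mp hd
  have hv0 : v ≠ 0 := norm_pos_iff.mp (by rw [hd']; positivity)
  have e : (u ^ 2)⁻¹ - (v ^ 2)⁻¹ = (v - u) * (v + u) / (u ^ 2 * v ^ 2) := by
    field_simp; ring
  have hvu : ‖v - u‖ = 1 / r - r := by
    have : v - u = ((r - 1 / r : ℝ) : ℂ) * ζ₀ := by
      rw [hu, hv]; push_cast; ring
    rw [this, norm_mul, hζ₀, Complex.norm_real, Real.norm_eq_abs, abs_of_neg, mul_one]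
    · ring
    · have : 1 < 1 / r := by rw [lt_div_iff₀ hr]; linarith
      linarith
  have hvu' : ‖v + u‖ ≤ d / r + d := (norm_add_le _ _).trans_eq (by rw [hd'])
  have hpos : 0 ≤ 1 / r - r := by rw [← hvu]; exact norm_nonneg _
  rw [e, norm_div, norm_mul, norm_mul, norm_pow, norm_pow, hd', hvu]
  calc (1 / r - r) * ‖v + u‖ / (d ^ 2 * (d / r) ^ 2)
      ≤ (1 / r - r) * (d / r + d) / (d ^ 2 * (d / r) ^ 2) := by gcongr
    _ = (1 - r) * (1 + r) ^ 2 / d ^ 3 := by field_simp; ring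
    _ ≤ 4 * (1 - r) / d ^ 3 := by
        have : (1 + r) ^ 2 ≤ 4 := by nlinarith
        rw [mul_comm 4]
        gcongr

theorem circleIntegral_poisson (w : ℂ) (hw : ‖w‖ < 1) :
    ∫ θ in (0:ℝ)..(2 * Real.pi), (1 - ‖w‖ ^ 2) / ‖circleMap 0 1 θ - w‖ ^ 2 = 2 * Real.pi := by
  have h := (diffContOnCl_const (c := (1 : ℂ))).circleAverage_poissonKernel_smul'
    (c := 0) (R := 1) (mem_ball_zero_iff.mpr hw)
  simp only [Real.circleAverage, sub_zero, norm_circleMap_zero, abs_one, one_pow, real_smul,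
    mul_one] at h
  rw [intervalIntegral.integral_ofReal] at h
  norm_cast at h
  rwa [inv_mul_eq_one₀ Real.two_pi_pos.ne', eq_comm] at h

/-- If `h` is continuous on the closed disk, holomorphic inside, and vanishes to higher than first
order at a boundary point along the circle, then its derivative has radial limit `0` there. -/
theorem tendsto_deriv_radial {h : ℂ → ℂ} (hh : DiffContOnCl ℂ h (Metric.ball 0 1))
    {ζ₀ : ℂ} (hζ₀ : ‖ζ₀‖ = 1) {M : ℝ} (hM : ∀ ζ, ‖h ζ‖ ≤ M * ‖ζ - ζ₀‖)
    (ho : ∀ ε > 0, ∃ δ > 0, ∀ ζ, ‖ζ‖ = 1 → ‖ζ - ζ₀‖ < δ → ‖h ζ‖ ≤ ε * ‖ζ - ζ₀‖) :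
    Tendsto (fun r : ℝ => deriv h (r * ζ₀)) (nhdsWithin 1 (Iio 1)) (nhds 0) := by
  have hM0 : 0 ≤ M := by
    have := (norm_nonneg _).trans (hM (2 * ζ₀))
    rw [show 2 * ζ₀ - ζ₀ = ζ₀ by ring, hζ₀] at this; linarith
  have key : ∀ ε > 0, ∀ δ > 0, (∀ ζ, ‖ζ‖ = 1 → ‖ζ - ζ₀‖ < δ → ‖h ζ‖ ≤ ε * ‖ζ - ζ₀‖) →
      ∀ r : ℝ, 0 < r → r < 1 → ‖deriv h (r * ζ₀)‖ ≤ 8 * ε + 32 * M * (1 - r) / δ ^ 2 := by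
    intro ε hε δ hδ hloc r hr hr1
    have hn : ‖r * ζ₀‖ = r := by
      rw [norm_mul, hζ₀, Complex.norm_real, Real.norm_of_nonneg hr.le]; ring
    have hr0 : (r : ℂ) ≠ 0 := by exact_mod_cast hr.ne'
    have hz : r * ζ₀ ∈ Metric.ball (0 : ℂ) 1 := by rw [mem_ball_zero_iff, hn]; exact hr1
    have hz' : ∀ ζ ∈ Metric.closedBall (0 : ℂ) 1, (ζ - ζ₀ / r) ^ 2 ≠ 0 := by
      intro ζ hζ h0
      have : ζ = ζ₀ / r := sub_eq_zero.mp (sq_eq_zero_iff.mp h0)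
      rw [mem_closedBall_zero_iff, this, norm_div, hζ₀, Complex.norm_real,
        Real.norm_of_nonneg hr.le, div_le_one hr] at hζ
      linarith
    have hcl : closure (Metric.ball (0 : ℂ) 1) = Metric.closedBall 0 1 := closure_ball _ one_ne_zero
    have hcont : ContinuousOn h (Metric.closedBall 0 1) := hh.continuousOn_ball
    have hk' : DiffContOnCl ℂ (fun ζ => ((ζ - ζ₀ / r) ^ 2)⁻¹) (Metric.ball 0 1) := by
      refine DifferentiableOn.diffContOnCl ?_
      rw [hcl]
      exact DifferentiableOn.inv (by fun_prop) hz'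
    have e1 := hh.two_pi_I_inv_smul_circleIntegral_sub_sq_inv_smul hz
    have e2 := (hk'.smul hh).circleIntegral_eq_zero zero_le_one
    have i1 : CircleIntegrable (fun z : ℂ => ((z - r * ζ₀) ^ 2)⁻¹ • h z) 0 1 := by
      refine ContinuousOn.circleIntegrable zero_le_one ?_
      refine ContinuousOn.fun_smul ?_ (hcont.mono Metric.sphere_subset_closedBall)
      refine ((continuous_id'.sub continuous_const).pow 2).continuousOn.inv₀ fun u hu h => ?_
      exact Metric.sphere_disjoint_ball.ne_of_mem hu hz (sub_eq_zero.mp (sq_eq_zero_iff.mp h))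
    have i2 : CircleIntegrable (fun z : ℂ => ((z - ζ₀ / r) ^ 2)⁻¹ • h z) 0 1 :=
      ContinuousOn.circleIntegrable zero_le_one
        ((hk'.smul hh).continuousOn_ball.mono Metric.sphere_subset_closedBall)
    have e3 : deriv h (r * ζ₀) = (2 * Real.pi * I : ℂ)⁻¹ • ∮ z in C(0, 1),
        (((z - r * ζ₀) ^ 2)⁻¹ - ((z - ζ₀ / r) ^ 2)⁻¹) • h z := by
      simp only [sub_smul]
      rw [circleIntegral.integral_sub i1 i2, ← e1]
      erw [e2]
      rw [sub_zero]
    set B : ℝ → ℝ := fun θ => 8 * ε * ((1 - ‖r * ζ₀‖ ^ 2) / ‖circleMap 0 1 θ - r * ζ₀‖ ^ 2)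
      + 32 * M * (1 - r) / δ ^ 2 with hB
    have hdpos : ∀ θ, 1 - r ≤ ‖circleMap 0 1 θ - r * ζ₀‖ := fun θ => by
      have := norm_sub_norm_le (circleMap 0 1 θ) (r * ζ₀)
      rw [hn] at this; simpa using this
    have hpt : ∀ θ : ℝ, ‖deriv (circleMap 0 1) θ • ((((circleMap 0 1 θ - r * ζ₀) ^ 2)⁻¹ -
        ((circleMap 0 1 θ - ζ₀ / r) ^ 2)⁻¹) • h (circleMap 0 1 θ))‖ ≤ B θ := by
      intro θ
      have hc : ‖circleMap 0 1 θ‖ = 1 := by simp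
      have hd := hdpos θ
      rw [norm_smul, norm_smul, deriv_circleMap, norm_mul, hc, Complex.norm_I, one_mul, one_mul]
      have hker := norm_sq_inv_sub_sq_inv_le hc hζ₀ hr hr1
      set ζ := circleMap 0 1 θ
      set d := ‖ζ - r * ζ₀‖ with hdd
      have hd0 : 0 < d := by linarith
      have h2d : ‖ζ - ζ₀‖ ≤ 2 * d := by
        have : ζ - ζ₀ = (ζ - r * ζ₀) + ((r - 1 : ℝ) : ℂ) * ζ₀ := by push_cast; ring
        rw [this]
        refine (norm_add_le _ _).trans ?_
        rw [norm_mul, hζ₀, Complex.norm_real, Real.norm_eq_abs, abs_of_neg (by linarith)]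
        linarith
      have hr' : 0 < 1 - r := by linarith
      by_cases hnear : ‖ζ - ζ₀‖ < δ
      · calc _ ≤ (4 * (1 - r) / d ^ 3) * (ε * (2 * d)) := by
              gcongr
              exact (hloc ζ hc hnear).trans (by gcongr)
          _ = 8 * ε * ((1 - r) / d ^ 2) := by field_simp; ring
          _ ≤ 8 * ε * ((1 - ‖r * ζ₀‖ ^ 2) / d ^ 2) := by rw [hn]; gcongr; nlinarith
          _ ≤ B θ := by rw [hB]; simp only; have : 0 ≤ 32 * M * (1 - r) / δ ^ 2 := by positivity
                        linarith
      · have hdδ : δ / 2 ≤ d := by linarith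
        calc _ ≤ (4 * (1 - r) / d ^ 3) * (M * (2 * d)) := by
              gcongr
              exact (hM ζ).trans (by gcongr)
          _ = 8 * M * (1 - r) / d ^ 2 := by field_simp; ring
          _ ≤ 8 * M * (1 - r) / (δ / 2) ^ 2 := by gcongr
          _ = 32 * M * (1 - r) / δ ^ 2 := by field_simp; ring
          _ ≤ B θ := by
            rw [hB]; simp only
            have : 0 ≤ (1 - ‖r * ζ₀‖ ^ 2) / ‖circleMap 0 1 θ - r * ζ₀‖ ^ 2 := by
              rw [hn]
              have : 0 ≤ 1 - r ^ 2 := by nlinarith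
              positivity
            have : 0 ≤ 8 * ε * ((1 - ‖r * ζ₀‖ ^ 2) / ‖circleMap 0 1 θ - r * ζ₀‖ ^ 2) := by
              positivity
            linarith
    have hc1 : Continuous fun θ : ℝ =>
        (1 - ‖r * ζ₀‖ ^ 2) / ‖circleMap 0 1 θ - r * ζ₀‖ ^ 2 := by
      refine Continuous.div continuous_const (by fun_prop) fun θ => ?_
      have : 0 < ‖circleMap 0 1 θ - r * ζ₀‖ := by linarith [hdpos θ]
      positivity
    have hBint : ∫ θ in (0:ℝ)..(2 * Real.pi), B θ =
        2 * Real.pi * (8 * ε + 32 * M * (1 - r) / δ ^ 2) := by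
      rw [hB, intervalIntegral.integral_add, intervalIntegral.integral_const_mul,
        circleIntegral_poisson _ (by rw [hn]; exact hr1), intervalIntegral.integral_const, smul_eq_mul]
      · ring
      · exact (hc1.const_mul _).intervalIntegrable _ _
      · exact intervalIntegrable_const
    have hle : ‖∮ z in C(0, 1), (((z - r * ζ₀) ^ 2)⁻¹ - ((z - ζ₀ / r) ^ 2)⁻¹) • h z‖ ≤
        2 * Real.pi * (8 * ε + 32 * M * (1 - r) / δ ^ 2) := by
      rw [← hBint]
      refine intervalIntegral.norm_integral_le_of_norm_le Real.two_pi_pos.le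
        (Eventually.of_forall fun θ _ => hpt θ) ?_
      exact ((hc1.const_mul _).add continuous_const).intervalIntegrable _ _
    rw [e3, norm_smul]
    have : ‖(2 * Real.pi * I : ℂ)⁻¹‖ = (2 * Real.pi)⁻¹ := by
      simp [abs_of_pos Real.pi_pos]
    rw [this, inv_mul_le_iff₀ Real.two_pi_pos]
    exact hle
  rw [Metric.tendsto_nhds]
  intro ε hε
  obtain ⟨δ, hδ, hloc⟩ := ho (ε / 16) (by positivity)
  have hlim : Tendsto (fun r : ℝ => 8 * (ε / 16) + 32 * M * (1 - r) / δ ^ 2)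
      (nhdsWithin 1 (Iio 1)) (nhds (8 * (ε / 16) + 32 * M * (1 - 1) / δ ^ 2)) :=
    ((Continuous.tendsto (by fun_prop) 1).mono_left nhdsWithin_le_nhds)
  have hev := hlim.eventually_lt_const (show _ < ε by simp; linarith)
  have h0 : ∀ᶠ r : ℝ in nhdsWithin 1 (Iio 1), 0 < r :=
    nhdsWithin_le_nhds (lt_mem_nhds one_pos)
  filter_upwards [hev, h0, self_mem_nhdsWithin] with r h1 h2 h3
  rw [dist_zero_right]
  exact (key _ (by positivity) δ hδ hloc r h2 h3).trans_lt h1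

theorem hasDerivAt_uc (θ : ℝ) : HasDerivAt uc (uc θ * I) θ := by
  have h : HasDerivAt (fun t : ℝ => (t : ℂ) * I) (1 * I) θ :=
    (Complex.ofRealCLM.hasDerivAt (x := θ)).mul_const I
  rw [one_mul] at h
  exact h.cexp

/-- A function along the circle with vanishing derivative is little-o of the chordal distance. -/
theorem exists_norm_le_of_hasDerivAt_comp_uc {h : ℂ → ℂ} {θ₀ : ℝ}
    (h0 : h (uc θ₀) = 0) (hd : HasDerivAt (fun θ => h (uc θ)) 0 θ₀) {ε : ℝ} (hε : 0 < ε) :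
    ∃ δ > 0, ∀ ζ, ‖ζ‖ = 1 → ‖ζ - uc θ₀‖ < δ → ‖h ζ‖ ≤ ε * ‖ζ - uc θ₀‖ := by
  set ℓ : ℂ → ℝ := fun ζ => θ₀ + (Complex.log (ζ / uc θ₀)).im with hℓ
  have hℓ0 : ℓ (uc θ₀) = θ₀ := by simp [hℓ, uc_ne_zero]
  have hℓd : DifferentiableAt ℝ ℓ (uc θ₀) := by
    have h1 : DifferentiableAt ℂ (fun ζ => Complex.log (ζ / uc θ₀)) (uc θ₀) := by
      refine DifferentiableAt.clog (by fun_prop) ?_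
      rw [div_self (uc_ne_zero _)]
      exact Complex.one_mem_slitPlane
    exact (Complex.imCLM.differentiableAt.comp _ (h1.restrictScalars ℝ)).const_add θ₀
  have hcomp : HasFDerivAt (fun ζ => h (uc (ℓ ζ))) (0 : ℂ →L[ℝ] ℂ) (uc θ₀) := by
    have h1 : HasFDerivAt (fun θ => h (uc θ)) (0 : ℝ →L[ℝ] ℂ) (ℓ (uc θ₀)) := by
      rw [hℓ0]; simpa using! hd.hasFDerivAt
    simpa using! h1.comp (uc θ₀) hℓd.hasFDerivAt
  have hev := hcomp.isLittleO.def hε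
  obtain ⟨δ, hδ, H⟩ := Metric.eventually_nhds_iff.mp hev
  refine ⟨δ, hδ, fun ζ hζ hζδ => ?_⟩
  have h2 := H (y := ζ) (by rwa [dist_eq_norm])
  have h3 : uc (ℓ ζ) = ζ := by
    have hn : ‖ζ / uc θ₀‖ = 1 := by rw [norm_div, hζ, norm_uc, div_one]
    have hne : ζ / uc θ₀ ≠ 0 := norm_pos_iff.mp (by rw [hn]; exact one_pos)
    have : ((Complex.log (ζ / uc θ₀)).im : ℂ) * I = Complex.log (ζ / uc θ₀) := by
      apply Complex.ext
      · rw [Complex.log_re, hn]; simp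
      · simp
    have e : uc (ℓ ζ) = uc θ₀ * Complex.exp (((Complex.log (ζ / uc θ₀)).im : ℂ) * I) := by
      simp only [uc, hℓ, ← Complex.exp_add]
      push_cast
      ring_nf
    rw [e, this, Complex.exp_log hne, mul_div_cancel₀ _ (uc_ne_zero _)]
  simpa [h3, hℓ0, h0] using h2

/-- **Fatou's theorem**: a bounded holomorphic function on the disk has radial limits almost
everywhere. -/
theorem ae_exists_tendsto_radial {f : ℂ → ℂ} (hf : DifferentiableOn ℂ f unitDisk) {C : ℝ}
    (hC : ∀ z ∈ unitDisk, ‖f z‖ ≤ C) :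
    ∀ᵐ θ : ℝ, ∃ L, Tendsto (fun r : ℝ => f (r * uc θ)) (nhdsWithin 1 (Iio 1)) (nhds L) := by
  obtain ⟨Φ, hΦ⟩ := DifferentiableOn.isExactOn_ball hf
  have hlip : LipschitzOnWith C.toNNReal Φ (Metric.ball 0 1) :=
    (convex_ball (0 : ℂ) 1).lipschitzOnWith_of_nnnorm_hasDerivWithin_le
      (fun z hz => (hΦ z hz).hasDerivWithinAt) fun z hz => by
        rw [← NNReal.coe_le_coe, coe_nnnorm]
        exact (hC z hz).trans (Real.le_coe_toNNReal C)
  obtain ⟨g, hg, hgΦ⟩ := hlip.extend_finite_dimension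
  set K := lipschitzExtensionConstant ℂ * C.toNNReal
  have hgd : ∀ z ∈ Metric.ball (0 : ℂ) 1, HasDerivAt g (f z) z := fun z hz =>
    (hΦ z hz).congr_of_eventuallyEq
      ((hgΦ.eventuallyEq_of_mem (Metric.isOpen_ball.mem_nhds hz)).symm)
  have huc : LipschitzWith 1 uc := lipschitzWith_of_nnnorm_deriv_le
    (fun θ => (hasDerivAt_uc θ).differentiableAt) fun θ => by
      rw [(hasDerivAt_uc θ).deriv, ← NNReal.coe_le_coe]
      simp [norm_uc]
  filter_upwards [(hg.comp huc).ae_differentiableAt_real] with θ₀ hθ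
  set ζ₀ := uc θ₀ with hζ₀
  set A := deriv (g ∘ uc) θ₀ / (ζ₀ * I) with hA
  have hne : ζ₀ * I ≠ 0 := mul_ne_zero (uc_ne_zero _) I_ne_zero
  set h : ℂ → ℂ := fun ζ => g ζ - g ζ₀ - A * (ζ - ζ₀) with hh
  have hhd : ∀ z ∈ Metric.ball (0 : ℂ) 1, HasDerivAt h (f z - A) z := fun z hz => by
    simpa using! ((hgd z hz).sub_const (g ζ₀)).sub (((hasDerivAt_id z).sub_const ζ₀).const_mul A)
  have hcl : DiffContOnCl ℂ h (Metric.ball 0 1) :=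
    ⟨fun z hz => (hhd z hz).differentiableAt.differentiableWithinAt, by
      have := hg.continuous
      exact Continuous.continuousOn (by fun_prop)⟩
  have hder : HasDerivAt (fun θ => h (uc θ)) 0 θ₀ := by
    have h1 := (hθ.hasDerivAt.sub_const (g ζ₀)).sub
      (((hasDerivAt_uc θ₀).sub_const ζ₀).const_mul A)
    have e : deriv (g ∘ uc) θ₀ - A * (uc θ₀ * I) = 0 := by
      rw [hA, ← hζ₀, div_mul_cancel₀ _ hne, sub_self]
    rw [e] at h1
    exact h1
  have hlim := tendsto_deriv_radial hcl (norm_uc θ₀) (M := K + ‖A‖)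
    (fun ζ => by
      refine (norm_sub_le _ _).trans ?_
      rw [norm_mul, add_mul]
      gcongr
      exact hg.norm_sub_le ζ ζ₀)
    (fun ε hε => exists_norm_le_of_hasDerivAt_comp_uc (by simp [hh, hζ₀]) hder hε)
  refine ⟨A, ?_⟩
  have hsum := hlim.add_const A
  rw [zero_add] at hsum
  refine hsum.congr' ?_
  have h0 : ∀ᶠ r : ℝ in nhdsWithin 1 (Iio 1), 0 < r :=
    nhdsWithin_le_nhds (lt_mem_nhds one_pos)
  filter_upwards [h0, self_mem_nhdsWithin] with r hr hr1
  rw [(hhd _ (ofReal_mul_uc_mem hr.le hr1 θ₀)).deriv, sub_add_cancel]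

/-- A nowhere zero bounded holomorphic function has no radial limit `0` on a set of positive
measure. -/
theorem ae_not_tendsto_radial_zero {H : ℂ → ℂ} (hH : DifferentiableOn ℂ H unitDisk)
    (hne : ∀ z ∈ unitDisk, H z ≠ 0) {C : ℝ} (hC : ∀ z ∈ unitDisk, ‖H z‖ ≤ C) :
    ∀ᵐ θ ∂bMeasure,
      ¬ Tendsto (fun r : ℝ => H (r * uc θ)) (nhdsWithin 1 (Iio 1)) (nhds 0) := by
  have hmem0 : (0 : ℂ) ∈ unitDisk := by simp [unitDisk]
  have hCpos : 0 < C := (norm_pos_iff.mpr (hne 0 hmem0)).trans_le (hC 0 hmem0)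
  obtain ⟨s, -, hs, hslim⟩ := exists_seq_strictMono_tendsto' (show (0 : ℝ) < 1 from one_pos)
  have hs0 : ∀ n, 0 ≤ s n := fun n => (hs n).1.le
  have hs1 : ∀ n, s n < 1 := fun n => (hs n).2
  have hslim' : Tendsto s atTop (nhdsWithin 1 (Iio 1)) :=
    tendsto_nhdsWithin_iff.mpr ⟨hslim, Eventually.of_forall hs1⟩
  set F : ℕ → ℝ → ℝ := fun n θ => Real.log C - Real.log ‖H (s n * uc θ)‖ with hF
  have huc : Continuous uc := by unfold uc; fun_prop
  have hcont : ∀ n, Continuous (F n) := fun n => by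
    refine continuous_const.sub (Continuous.log (Continuous.norm ?_) fun θ => ?_)
    · exact hH.continuousOn.comp_continuous (continuous_const.mul huc)
        fun θ => ofReal_mul_uc_mem (hs0 n) (hs1 n) θ
    · exact norm_ne_zero_iff.mpr (hne _ (ofReal_mul_uc_mem (hs0 n) (hs1 n) θ))
  have hnonneg : ∀ n θ, 0 ≤ F n θ := fun n θ => by
    have hm := ofReal_mul_uc_mem (hs0 n) (hs1 n) θ
    exact sub_nonneg.mpr (Real.log_le_log (norm_pos_iff.mpr (hne _ hm)) (hC _ hm))
  have hint : ∀ n, ∫⁻ θ, ENNReal.ofReal (F n θ) ∂bMeasure =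
      ENNReal.ofReal (2 * Real.pi * (Real.log C - Real.log ‖H 0‖)) := fun n => by
    have hsub : Metric.closedBall (0 : ℂ) |s n| ⊆ unitDisk := by
      rw [abs_of_nonneg (hs0 n)]
      exact Metric.closedBall_subset_ball (hs1 n)
    have han : AnalyticOnNhd ℂ H (Metric.closedBall 0 |s n|) :=
      (hH.analyticOnNhd Metric.isOpen_ball).mono hsub
    have havg := han.circleAverage_log_norm_of_ne_zero fun u hu => hne u (hsub hu)
    have hii : IntervalIntegrable (F n) volume 0 (2 * Real.pi) := (hcont n).intervalIntegrable _ _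
    rw [bMeasure, ← ofReal_integral_eq_lintegral_ofReal, ← intervalIntegral.integral_of_le
      Real.two_pi_pos.le]
    · congr 1
      have h2 : ∫ θ in (0:ℝ)..(2 * Real.pi), Real.log ‖H (s n * uc θ)‖ =
          2 * Real.pi * Real.log ‖H 0‖ := by
        rw [← havg, Real.circleAverage, smul_eq_mul, mul_inv_cancel_left₀ Real.two_pi_pos.ne']
        simp [circleMap, uc]
      have h3 : IntervalIntegrable (fun θ => Real.log ‖H (s n * uc θ)‖) volume 0
          (2 * Real.pi) := by
        refine Continuous.intervalIntegrable ?_ _ _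
        simpa [hF] using (continuous_const (y := Real.log C)).fun_sub (hcont n)
      rw [intervalIntegral.integral_sub intervalIntegrable_const h3, h2,
        intervalIntegral.integral_const, smul_eq_mul]
      ring
    · exact (intervalIntegrable_iff_integrableOn_Ioc_of_le Real.two_pi_pos.le).mp hii
    · exact Eventually.of_forall (hnonneg n)
  have hmeas : ∀ n, Measurable fun θ => ENNReal.ofReal (F n θ) := fun n =>
    (hcont n).measurable.ennreal_ofReal
  have hfin : ∫⁻ θ, liminf (fun n => ENNReal.ofReal (F n θ)) atTop ∂bMeasure ≠ ⊤ := by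
    refine ne_top_of_le_ne_top ?_ (lintegral_liminf_le hmeas)
    simp only [hint, liminf_const]
    exact ENNReal.ofReal_ne_top
  filter_upwards [ae_lt_top (Measurable.liminf hmeas) hfin] with θ hθ htend
  have h1 : Tendsto (fun n => ‖H (s n * uc θ)‖) atTop (nhdsWithin 0 {0}ᶜ) := by
    refine tendsto_nhdsWithin_iff.mpr ⟨?_, Eventually.of_forall fun n => ?_⟩
    · simpa using (htend.comp hslim').norm
    · exact norm_ne_zero_iff.mpr (hne _ (ofReal_mul_uc_mem (hs0 n) (hs1 n) θ))
  have h2 : Tendsto (fun n => F n θ) atTop atTop := by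
    have := tendsto_neg_atBot_atTop.comp (Real.tendsto_log_nhdsNE_zero.comp h1)
    exact (tendsto_atTop_add_const_left _ (Real.log C) this).congr fun n => by
      simp [hF, sub_eq_add_neg]
  have h3 := (ENNReal.tendsto_ofReal_atTop.comp h2).liminf_eq
  simp only [Function.comp_def] at h3
  exact hθ.ne h3

/-! ### Pairs -/

theorem bdry_eq {f : ℂ → ℂ} {θ : ℝ} {L : ℂ}
    (h : Tendsto (fun r : ℝ => f (r * uc θ)) (nhdsWithin 1 (Iio 1)) (nhds L)) :
    bdry f θ = L :=
  h.limUnder_eq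

theorem bdry_eq_of_eqOn_const {f : ℂ → ℂ} {k : ℂ} (h : ∀ z ∈ unitDisk, f z = k) (θ : ℝ) :
    bdry f θ = k := by
  refine bdry_eq (tendsto_const_nhds.congr' ?_)
  have h0 : ∀ᶠ r : ℝ in nhdsWithin 1 (Iio 1), 0 < r := nhdsWithin_le_nhds (lt_mem_nhds one_pos)
  filter_upwards [h0, self_mem_nhdsWithin] with r hr hr1
  exact (h _ (ofReal_mul_uc_mem hr.le hr1 θ)).symm

theorem ae_bMeasure_neBot : (ae bMeasure).NeBot := by
  rw [ae_neBot, bMeasure, Ne, Measure.restrict_eq_zero]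
  simp [Real.pi_pos]

theorem re_herglotz_nonneg {z : ℂ} (hz : z ∈ unitDisk) (θ : ℝ) :
    0 ≤ ((uc θ + z) / (uc θ - z)).re := by
  have h := le_re_herglotzRieszKernel (c := 0) (R := 1) (z := uc θ) (w := z)
    (by simp [norm_uc]) hz
  simp only [sub_zero] at h
  refine le_trans ?_ h
  have : ‖z‖ < 1 := mem_ball_zero_iff.mp hz
  exact div_nonneg (by linarith) (by positivity)

theorem IsOuter.norm_le_one {a : ℂ → ℂ} (ha : IsOuter a) (hb : ∀ᵐ θ ∂bMeasure, ‖bdry a θ‖ ≤ 1) :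
    ∀ z ∈ unitDisk, ‖a z‖ ≤ 1 := by
  obtain ⟨-, c, hc, h⟩ := ha
  intro z hz
  rw [h z hz, norm_mul, hc, one_mul, Complex.norm_exp, Real.exp_le_one_iff]
  set u : ℝ → ℂ := fun θ => ((uc θ + z) / (uc θ - z)) * ((Real.log ‖bdry a θ‖ : ℝ) : ℂ) with hu
  have hre : (∫ θ in (0:ℝ)..(2 * Real.pi), u θ).re ≤ 0 := by
    rw [intervalIntegral.integral_of_le Real.two_pi_pos.le]
    by_cases hi : Integrable u bMeasure
    · have := integral_re hi
      rw [bMeasure] at this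
      change (∫ θ in Ioc 0 (2 * Real.pi), (u θ).re) = (∫ θ in Ioc 0 (2 * Real.pi), u θ).re at this
      rw [← this]
      refine integral_nonpos_of_ae ?_
      filter_upwards [hb] with θ hθ
      simp only [hu, Complex.re_mul_ofReal]
      exact mul_nonpos_of_nonneg_of_nonpos (re_herglotz_nonneg hz θ)
        (Real.log_nonpos (norm_nonneg _) hθ)
    · rw [bMeasure] at hi
      rw [integral_undef hi, Complex.zero_re]
  have e : (1 / (2 * (Real.pi : ℂ))) = ((1 / (2 * Real.pi) : ℝ) : ℂ) := by push_cast; rfl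
  rw [e, Complex.re_ofReal_mul]
  exact mul_nonpos_of_nonneg_of_nonpos (by positivity) hre

theorem IsPair.ae_norm_bdry_le {b a : ℂ → ℂ} (h : IsPair b a) :
    ∀ᵐ θ ∂bMeasure, ‖bdry a θ‖ ≤ 1 := by
  filter_upwards [h.2.2] with θ hθ
  nlinarith [sq_nonneg ‖bdry b θ‖, norm_nonneg (bdry a θ)]

/-- In a pair `(b, a)`, the function `b` is not a unimodular constant. -/
theorem IsPair.norm_lt_one {b a : ℂ → ℂ} (h : IsPair b a) {w : ℂ} (hw : w ∈ unitDisk) :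
    ‖b w‖ < 1 := by
  refine (h.1.2.1 w hw).lt_of_ne fun hbw => ?_
  have hmax : IsMaxOn (norm ∘ b) unitDisk w := fun z hz => by
    simpa [hbw] using h.1.2.1 z hz
  have hconst := Complex.eqOn_of_isPreconnected_of_isMaxOn_norm
    (convex_ball (0 : ℂ) 1).isPreconnected Metric.isOpen_ball h.1.1 hw hmax
  have hb : ∀ θ, bdry b θ = b w := bdry_eq_of_eqOn_const hconst
  have ha : ∀ᵐ θ ∂bMeasure, bdry a θ = 0 := by
    filter_upwards [h.2.2] with θ hθ
    rw [hb, hbw] at hθ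
    simpa using hθ
  obtain ⟨-, c, hc, hac⟩ := h.2.1
  have hac' : ∀ z ∈ unitDisk, a z = c := fun z hz => by
    rw [hac z hz, intervalIntegral.integral_of_le Real.two_pi_pos.le, integral_eq_zero_of_ae]
    · simp
    · filter_upwards [ha] with θ hθ
      simp [hθ]
  have := ae_bMeasure_neBot
  obtain ⟨θ, hθ⟩ := ha.exists
  rw [bdry_eq_of_eqOn_const hac'] at hθ
  simp [hθ] at hc

theorem one_sub_mul_ne_zero_of_norm_lt_one {u v : ℂ} (hu : ‖u‖ ≤ 1) (hv : ‖v‖ < 1) :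
    1 - u * v ≠ 0 := fun h => by
  have h1 : u * v = 1 := (sub_eq_zero.mp h).symm
  have h2 : ‖u‖ * ‖v‖ = 1 := by rw [← norm_mul, h1, norm_one]
  nlinarith [norm_nonneg u, norm_nonneg v]

/-- The function `a / (1 - λ̄ b)` has radial limits almost everywhere. -/
theorem IsPair.ae_exists_tendsto_div {b a : ℂ → ℂ} (h : IsPair b a) {lam : ℂ} (hlam : ‖lam‖ = 1) :
    ∀ᵐ θ ∂bMeasure, ∃ L, Tendsto
      (fun r : ℝ => a (r * uc θ) / (1 - (starRingEnd ℂ) lam * b (r * uc θ)))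
      (nhdsWithin 1 (Iio 1)) (nhds L) := by
  have hlam' : ‖(starRingEnd ℂ) lam‖ = 1 := by rw [RCLike.norm_conj, hlam]
  have hH : DifferentiableOn ℂ (fun z => 1 - (starRingEnd ℂ) lam * b z) unitDisk :=
    (differentiableOn_const 1).sub (h.1.1.const_mul _)
  have hne : ∀ z ∈ unitDisk, 1 - (starRingEnd ℂ) lam * b z ≠ 0 := fun z hz =>
    one_sub_mul_ne_zero_of_norm_lt_one hlam'.le (h.norm_lt_one hz)
  have hbd : ∀ z ∈ unitDisk, ‖1 - (starRingEnd ℂ) lam * b z‖ ≤ 2 := fun z hz => by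
    refine (norm_sub_le _ _).trans ?_
    rw [norm_mul, hlam', norm_one]
    linarith [h.1.2.1 z hz]
  have ha := ae_exists_tendsto_radial h.2.1.1 (h.2.1.norm_le_one h.ae_norm_bdry_le)
  have hb := ae_exists_tendsto_radial hH hbd
  filter_upwards [ae_restrict_of_ae ha, ae_restrict_of_ae hb,
    ae_not_tendsto_radial_zero hH hne hbd] with θ ⟨La, hLa⟩ ⟨Lb, hLb⟩ h0
  exact ⟨La / Lb, hLa.div hLb fun h => h0 (h ▸ hLb)⟩

theorem tendsto_szKernel_radial {w : ℂ} (hw : w ∈ unitDisk) (θ : ℝ) :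
    Tendsto (fun r : ℝ => szKernel w (r * uc θ)) (nhdsWithin 1 (Iio 1))
      (nhds (szKernel w (uc θ))) := by
  have hne : 1 - (starRingEnd ℂ) w * uc θ ≠ 0 := by
    rw [mul_comm]
    refine one_sub_mul_ne_zero_of_norm_lt_one (norm_uc θ).le ?_
    rw [RCLike.norm_conj]
    exact mem_ball_zero_iff.mp hw
  have h1 : Tendsto (fun r : ℝ => 1 - (starRingEnd ℂ) w * (r * uc θ)) (nhdsWithin 1 (Iio 1))
      (nhds (1 - (starRingEnd ℂ) w * (((1 : ℝ) : ℂ) * uc θ))) :=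
    (Continuous.tendsto (by fun_prop) 1).mono_left nhdsWithin_le_nhds
  rw [Complex.ofReal_one, one_mul] at h1
  exact h1.inv₀ hne

theorem re_one_add_div_one_sub_pos {u : ℂ} (hu : ‖u‖ < 1) : 0 < ((1 + u) / (1 - u)).re := by
  have h := le_re_herglotzRieszKernel (c := 0) (R := 1) (z := 1) (w := u)
    (by simp) (mem_ball_zero_iff.mpr hu)
  simp only [sub_zero] at h
  exact (div_pos (by linarith) (by positivity)).trans_le h

/-- The Herglotz density `|a / (1 - λ̄ b)|²` is integrable when it represents
`(1 + λ̄ b) / (1 - λ̄ b)`. -/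
theorem HerglotzAC.intervalIntegrable {b a : ℂ → ℂ} {lam : ℂ} (hac : HerglotzAC b a lam)
    (hpair : IsPair b a) (hlam : ‖lam‖ = 1) :
    IntervalIntegrable (fun θ =>
      ‖bdry (fun u => a u / (1 - (starRingEnd ℂ) lam * b u)) θ‖ ^ 2) volume 0 (2 * Real.pi) := by
  by_contra hn
  have hmem0 : (0 : ℂ) ∈ unitDisk := by simp [unitDisk]
  have h0 := hac 0 hmem0
  have hB : ‖(starRingEnd ℂ) lam * b 0‖ < 1 := by
    rw [norm_mul, RCLike.norm_conj, hlam, one_mul]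
    exact hpair.norm_lt_one hmem0
  have hre := re_one_add_div_one_sub_pos hB
  have hz := congrArg Complex.re h0
  simp only [mul_zero, add_zero, sub_zero, div_one, one_mul] at hz
  rw [intervalIntegral.integral_ofReal, intervalIntegral.integral_undef hn] at hz
  simp at hz
  simp [hz] at hre

/-- Let `(b, a)` be a pair, `λ ∈ ∂𝔻` with absolutely continuous
Herglotz measure `μ_λ`, and `F_λ = a/(1 − λ̄b)`.  Then for every `w ∈ 𝔻`,
`(1 − λ̄ b(z)) · T_{F̄_λ}((1 − λ·conj(b(w))) F_λ k_w)(z) = k_w^b(z)` on `𝔻`;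
this expresses that the canonical isometry `V_{λ̄b}` of `H²(μ_λ)` onto `H(λ̄b)`
sends `(1 − λ·conj(b(w))) k_w` to `k_w^b`. -/
theorem Vb_of_szego_kernel (b a : ℂ → ℂ) (lam : ℂ)
    (hpair : IsPair b a) (hlam : ‖lam‖ = 1)
    (hac : HerglotzAC b a lam) :
    ∀ w ∈ unitDisk, ∀ z ∈ unitDisk,
      (1 - (starRingEnd ℂ) lam * b z) *
        toeplitz (conjBdry (fun u => a u / (1 - (starRingEnd ℂ) lam * b u)))
          (fun u => (1 - lam * (starRingEnd ℂ) (b w)) *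
            (a u / (1 - (starRingEnd ℂ) lam * b u)) * szKernel w u) z
        = hbKernel b w z := by
  intro w hw z hz
  set F : ℂ → ℂ := fun u => a u / (1 - (starRingEnd ℂ) lam * b u) with hF
  set g : ℝ → ℝ := fun θ => ‖bdry F θ‖ ^ 2 with hg
  set κ : ℂ := 1 - lam * (starRingEnd ℂ) (b w) with hκ
  have hgi := hac.intervalIntegrable hpair hlam
  have hz1 : ‖z‖ < 1 := mem_ball_zero_iff.mp hz
  have hw1 : ‖w‖ < 1 := mem_ball_zero_iff.mp hw
  have hlam' : ‖(starRingEnd ℂ) lam‖ = 1 := by rw [RCLike.norm_conj, hlam]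
  have huc : Continuous uc := by unfold uc; fun_prop
  have hne : ∀ v : ℂ, ‖v‖ < 1 → ∀ θ, 1 - (uc θ)⁻¹ * v ≠ 0 := fun v hv θ =>
    one_sub_mul_ne_zero_of_norm_lt_one (by rw [norm_inv, norm_uc, inv_one]) hv
  set P : ℂ → ℝ → ℂ := fun v θ => (1 + (uc θ)⁻¹ * v) / (1 - (uc θ)⁻¹ * v) with hP
  have hPc : ∀ v : ℂ, ‖v‖ < 1 → Continuous (P v) := fun v hv => by
    have : Continuous fun θ => (uc θ)⁻¹ := huc.inv₀ uc_ne_zero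
    exact Continuous.div (by fun_prop) (by fun_prop) (hne v hv)
  have hgc : IntervalIntegrable (fun θ => (g θ : ℂ)) volume 0 (2 * Real.pi) :=
    ⟨hgi.1.ofReal, hgi.2.ofReal⟩
  have hPi : ∀ v : ℂ, ‖v‖ < 1 →
      IntervalIntegrable (fun θ => P v θ * (g θ : ℂ)) volume 0 (2 * Real.pi) := fun v hv =>
    hgc.continuousOn_mul (hPc v hv).continuousOn
  have hPi' : IntervalIntegrable (fun θ => (starRingEnd ℂ) (P w θ) * (g θ : ℂ)) volume 0
      (2 * Real.pi) :=
    hgc.continuousOn_mul (Complex.continuous_conj.comp (hPc w hw1)).continuousOn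
  have hwz : 1 - (starRingEnd ℂ) w * z ≠ 0 :=
    one_sub_mul_ne_zero_of_norm_lt_one (by rw [RCLike.norm_conj]; exact hw1.le) hz1
  have hkey : ∀ᵐ θ ∂bMeasure,
      conjBdry F θ * bdry (fun u => κ * (a u / (1 - (starRingEnd ℂ) lam * b u)) * szKernel w u) θ *
        (1 - z * (uc θ)⁻¹)⁻¹ =
      κ / (2 * (1 - (starRingEnd ℂ) w * z)) *
        (P z θ * (g θ : ℂ) + (starRingEnd ℂ) (P w θ) * (g θ : ℂ)) := by
    filter_upwards [hpair.ae_exists_tendsto_div hlam] with θ ⟨L, hL⟩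
    have e1 : bdry F θ = L := bdry_eq hL
    have e2 : bdry (fun u => κ * (a u / (1 - (starRingEnd ℂ) lam * b u)) * szKernel w u) θ =
        κ * L * szKernel w (uc θ) := bdry_eq ((hL.const_mul κ).mul (tendsto_szKernel_radial hw θ))
    have e3 : (g θ : ℂ) = (starRingEnd ℂ) L * L := by
      rw [hg]
      simp only [e1]
      rw [Complex.conj_mul']
      push_cast
      rfl
    have hz2 := hne z hz1 θ
    have hw2 : 1 - uc θ * (starRingEnd ℂ) w ≠ 0 :=
      one_sub_mul_ne_zero_of_norm_lt_one (norm_uc θ).le (by rwa [RCLike.norm_conj])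
    have e4 : (starRingEnd ℂ) (P w θ) =
        (1 + uc θ * (starRingEnd ℂ) w) / (1 - uc θ * (starRingEnd ℂ) w) := by
      simp only [hP, uc_inv, map_div₀, map_add, map_sub, map_mul, map_one, Complex.conj_conj]
    have hu := uc_ne_zero θ
    rw [conjBdry, e1, e2, e3, e4]
    simp only [hP, szKernel]
    have hw3 : 1 - (starRingEnd ℂ) w * uc θ ≠ 0 := by rwa [mul_comm]
    have hz3 : 1 - z * (uc θ)⁻¹ ≠ 0 := by rwa [mul_comm]
    rw [mul_comm (uc θ) ((starRingEnd ℂ) w), mul_comm (uc θ)⁻¹ z]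
    have hmul : (z * (uc θ)⁻¹) * ((starRingEnd ℂ) w * uc θ) = (starRingEnd ℂ) w * z := by
      field_simp
    rw [← hmul] at hwz ⊢
    generalize z * (uc θ)⁻¹ = s at *
    generalize (starRingEnd ℂ) w * uc θ = t at *
    have hts : 1 - t * s ≠ 0 := by rwa [mul_comm]
    field_simp
    ring
  have hint : ∫ θ in (0:ℝ)..(2 * Real.pi), conjBdry F θ *
        bdry (fun u => κ * (a u / (1 - (starRingEnd ℂ) lam * b u)) * szKernel w u) θ *
        (1 - z * (uc θ)⁻¹)⁻¹ =
      κ / (2 * (1 - (starRingEnd ℂ) w * z)) *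
        ((∫ θ in (0:ℝ)..(2 * Real.pi), P z θ * (g θ : ℂ)) +
          (starRingEnd ℂ) (∫ θ in (0:ℝ)..(2 * Real.pi), P w θ * (g θ : ℂ))) := by
    have hc : (starRingEnd ℂ) (∫ θ in (0:ℝ)..(2 * Real.pi), P w θ * (g θ : ℂ)) =
        ∫ θ in (0:ℝ)..(2 * Real.pi), (starRingEnd ℂ) (P w θ) * (g θ : ℂ) := by
      simp only [intervalIntegral.integral_of_le Real.two_pi_pos.le]
      rw [← integral_conj]
      simp
    rw [hc, ← intervalIntegral.integral_add (hPi z hz1) hPi',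
      ← intervalIntegral.integral_const_mul]
    simp only [intervalIntegral.integral_of_le Real.two_pi_pos.le]
    exact integral_congr_ae hkey
  have hIz := hac z hz
  have hIw := congrArg (starRingEnd ℂ) (hac w hw)
  simp only [toeplitz, szProj]
  rw [hint]
  set Jz := ∫ θ in (0:ℝ)..(2 * Real.pi), P z θ * (g θ : ℂ) with hJz
  set Jw := ∫ θ in (0:ℝ)..(2 * Real.pi), P w θ * (g θ : ℂ) with hJw
  change _ = (1 / (2 * (Real.pi : ℂ))) * Jz + _ at hIz
  change _ = (starRingEnd ℂ) ((1 / (2 * (Real.pi : ℂ))) * Jw + _) at hIw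
  simp only [map_add, map_mul, map_div₀, map_sub, map_one, Complex.conj_conj, Complex.conj_ofReal,
    Complex.conj_I, map_ofNat] at hIw
  have hbz : 1 - (starRingEnd ℂ) lam * b z ≠ 0 :=
    one_sub_mul_ne_zero_of_norm_lt_one hlam'.le (hpair.norm_lt_one hz)
  have hbw : 1 - lam * (starRingEnd ℂ) (b w) ≠ 0 :=
    one_sub_mul_ne_zero_of_norm_lt_one hlam.le
      (by rw [RCLike.norm_conj]; exact hpair.norm_lt_one hw)
  have hll : (starRingEnd ℂ) lam * lam = 1 := by
    rw [Complex.conj_mul', hlam]; simp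
  have hsum : (1 / (2 * (Real.pi : ℂ))) * (Jz + (starRingEnd ℂ) Jw) =
      2 * (1 - b z * (starRingEnd ℂ) (b w)) /
        ((1 - (starRingEnd ℂ) lam * b z) * (1 - lam * (starRingEnd ℂ) (b w))) := by
    have : (1 / (2 * (Real.pi : ℂ))) * (Jz + (starRingEnd ℂ) Jw) =
        (1 + (starRingEnd ℂ) lam * b z) / (1 - (starRingEnd ℂ) lam * b z) +
        (1 + lam * (starRingEnd ℂ) (b w)) / (1 - lam * (starRingEnd ℂ) (b w)) := by
      rw [hIz, hIw]; ring
    rw [this, div_add_div _ _ hbz hbw]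
    congr 1
    linear_combination (-2 * b z * (starRingEnd ℂ) (b w)) * hll
  rw [hκ, hbKernel, mul_left_comm (1 / (2 * (Real.pi : ℂ))), hsum]
  field_simp

end
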